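/- arXiv:q-alg/9708008 — 4 statements merged into one kernel-verified Lean document; each statement's English description precedes it below -/
import Mathlib

section
/- Let P be the bosonic Fock space of the βγ-system, let s ∈ ℂ, and let J^N_m (N ∈ ℕ, m ∈ ℤ) be the operators defined in the context (the modes of the fields J^N(z) = :∂^Nβ(z)γ(z): + (1/(N+1))s(s−1)⋯(s−N)z^{−N−1}, which realize the W_{1+∞} algebra with central charge −1 on P). Then for every l ∈ ℤ: each J^N_m maps the charge-l subspace M^l into itself, and every nonzero linear subspace U ⊆ M^l with J^N_m(U) ⊆ U for all N ∈ ℕ and m ∈ ℤ is equal to M^l. (That is, M^l is an irreducible module over W_{1+∞} with central charge −1.) -/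
noncomputable section

/-- The bosonic Fock space of the βγ-system: the polynomial algebra on the variables
`x_n` (`n ≥ 0`, encoded as `Sum.inl n`) and `y_n` (`n ≥ 1`, encoded as `Sum.inr (n-1)`). -/
abbrev FockB : Type := MvPolynomial (ℕ ⊕ ℕ) ℂ

/-- The operator `β(n)`: for `n ≤ 0` multiplication by `x_{-n}`, for `n ≥ 1` the
operator `−∂/∂y_n`. -/
def betaOp (n : ℤ) : Module.End ℂ FockB :=
  if n ≤ 0 then LinearMap.mulLeft ℂ (MvPolynomial.X (Sum.inl (-n).toNat))
  else -(MvPolynomial.pderiv (Sum.inr (n - 1).toNat)).toLinearMap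

/-- The operator `γ(n)`: for `n ≥ 0` the operator `∂/∂x_n`, for `n ≤ -1`
multiplication by `y_{-n}`. -/
def gammaOp (n : ℤ) : Module.End ℂ FockB :=
  if 0 ≤ n then (MvPolynomial.pderiv (Sum.inl n.toNat)).toLinearMap
  else LinearMap.mulLeft ℂ (MvPolynomial.X (Sum.inr (-n - 1).toNat))

/-- The normally ordered product `:β(j)γ(k):`. -/
def nbg (j k : ℤ) : Module.End ℂ FockB :=
  if 1 ≤ j ∧ k ≤ -1 then gammaOp k ∘ₗ betaOp j else betaOp j ∘ₗ gammaOp k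

/-- The charge of a monomial exponent: (number of `y`-type factors) − (number of
`x`-type factors), counted with multiplicity. -/
def chargeB (d : (ℕ ⊕ ℕ) →₀ ℕ) : ℤ :=
  d.sum fun i k => match i with
    | Sum.inl _ => -(k : ℤ)
    | Sum.inr _ => (k : ℤ)

/-- `M^l`: the span of the monomials of charge `l`. -/
def MM (l : ℤ) : Submodule ℂ FockB :=
  Submodule.span ℂ
    {x | ∃ d : (ℕ ⊕ ℕ) →₀ ℕ, chargeB d = l ∧ x = MvPolynomial.monomial d 1}

/-- The modes `J^N_m` of the fields
`J^N(z) = :∂^Nβ(z)γ(z): + (1/(N+1))s(s−1)⋯(s−N)z^{−N−1}`,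
realizing `W_{1+∞}` with central charge `−1`:
`J^N_m x = Σ_j (∏_{i=0}^{N−1}(s−j−i))·:β(j)γ(m−j):·x + δ_{m,0}(1/(N+1))(∏_{i=0}^{N}(s−i))·x`
(a finite sum on each `x`). -/
def Jmode (s : ℂ) (N : ℕ) (m : ℤ) (x : FockB) : FockB :=
  (∑ᶠ j : ℤ, (∏ i ∈ Finset.range N, (s - (j : ℂ) - (i : ℂ))) • nbg j (m - j) x)
    + (if m = 0 then ((1 / ((N : ℂ) + 1)) * ∏ i ∈ Finset.range (N + 1), (s - (i : ℂ))) • x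
       else 0)

open MvPolynomial

lemma chargeB_add (d e : (ℕ ⊕ ℕ) →₀ ℕ) : chargeB (d + e) = chargeB d + chargeB e := by
  unfold chargeB
  refine Finsupp.sum_add_index' ?_ ?_
  · rintro (i | i) <;> simp
  · rintro (i | i) a b <;> push_cast <;> ring

lemma chargeB_single_inl (a n : ℕ) : chargeB (Finsupp.single (Sum.inl a) n) = -(n : ℤ) := by
  simp [chargeB]

lemma chargeB_single_inr (a n : ℕ) : chargeB (Finsupp.single (Sum.inr a) n) = (n : ℤ) := by
  simp [chargeB]

lemma pderiv_monomial_single_add (i : ℕ ⊕ ℕ) (c : (ℕ ⊕ ℕ) →₀ ℕ) :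
    pderiv i (monomial (Finsupp.single i 1 + c) (1 : ℂ)) =
      ((c i : ℂ) + 1) • monomial c (1 : ℂ) := by
  simp [pderiv_monomial, smul_monomial, add_comm]

lemma X_mul_monomial_one (i : ℕ ⊕ ℕ) (c : (ℕ ⊕ ℕ) →₀ ℕ) :
    X i * monomial c (1 : ℂ) = monomial (Finsupp.single i 1 + c) (1 : ℂ) := by
  simp [X, monomial_mul]

lemma monomial_mem_MM (d : (ℕ ⊕ ℕ) →₀ ℕ) : (monomial d (1 : ℂ)) ∈ MM (chargeB d) :=
  Submodule.subset_span ⟨d, rfl, rfl⟩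

lemma chargeB_eq_of_coeff_ne_zero {l : ℤ} {x : FockB} (hx : x ∈ MM l) {d : (ℕ ⊕ ℕ) →₀ ℕ}
    (hd : coeff d x ≠ 0) : chargeB d = l := by
  by_contra hne
  apply hd
  induction hx using Submodule.span_induction with
  | mem x h =>
    obtain ⟨e, he, rfl⟩ := h
    have : e ≠ d := fun h => hne (h ▸ he)
    simp [coeff_monomial, this]
  | zero => simp
  | add x y _ _ hx hy => simp_all [coeff_add]
  | smul a x _ hx => simp_all [coeff_smul]

/-- A linear endomorphism carrying monomials of charge `l` into `M^{l'}` carries `M^l`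
into `M^{l'}`. -/
lemma map_mem_MM {l l' : ℤ} (f : Module.End ℂ FockB)
    (hf : ∀ d, chargeB d = l → f (monomial d 1) ∈ MM l') {x : FockB} (hx : x ∈ MM l) :
    f x ∈ MM l' := by
  have : MM l ≤ (MM l').comap f := by
    refine Submodule.span_le.2 ?_
    rintro _ ⟨d, hd, rfl⟩
    exact hf d hd
  exact this hx

lemma X_mul_mem_MM {l : ℤ} (i : ℕ ⊕ ℕ) {x : FockB} (hx : x ∈ MM l) :
    X i * x ∈ MM (chargeB (Finsupp.single i 1) + l) := by
  refine map_mem_MM (LinearMap.mulLeft ℂ (X i)) (fun d hd => ?_) hx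
  rw [LinearMap.mulLeft_apply, X_mul_monomial_one, ← hd, ← chargeB_add]
  exact monomial_mem_MM _

lemma pderiv_mem_MM {l : ℤ} (i : ℕ ⊕ ℕ) {x : FockB} (hx : x ∈ MM l) :
    pderiv i x ∈ MM (l - chargeB (Finsupp.single i 1)) := by
  refine map_mem_MM (pderiv i).toLinearMap (fun d hd => ?_) hx
  by_cases h0 : d i = 0
  · simp [pderiv_monomial, h0]
  · obtain ⟨c, rfl⟩ : ∃ c, d = Finsupp.single i 1 + c :=
      le_iff_exists_add.1 (Finsupp.single_le_iff.2 (Nat.one_le_iff_ne_zero.2 h0))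
    rw [chargeB_add] at hd
    have hl : l - chargeB (Finsupp.single i 1) = chargeB c := by rw [← hd]; ring
    rw [hl, Derivation.coeFn_coe, pderiv_monomial_single_add]
    exact Submodule.smul_mem _ _ (monomial_mem_MM c)

lemma betaOp_mem_MM {l : ℤ} (n : ℤ) {x : FockB} (hx : x ∈ MM l) : betaOp n x ∈ MM (l - 1) := by
  unfold betaOp
  split_ifs
  · have h := X_mul_mem_MM (Sum.inl (-n).toNat) hx
    rw [chargeB_single_inl] at h
    rwa [show l - 1 = -((1 : ℕ) : ℤ) + l by push_cast; ring]
  · have h := pderiv_mem_MM (Sum.inr (n - 1).toNat) hx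
    rw [chargeB_single_inr] at h
    exact Submodule.neg_mem _ h

lemma gammaOp_mem_MM {l : ℤ} (n : ℤ) {x : FockB} (hx : x ∈ MM l) : gammaOp n x ∈ MM (l + 1) := by
  unfold gammaOp
  split_ifs
  · have h := pderiv_mem_MM (Sum.inl n.toNat) hx
    rw [chargeB_single_inl] at h
    rwa [show l + 1 = l - -((1 : ℕ) : ℤ) by push_cast; ring]
  · have h := X_mul_mem_MM (Sum.inr (-n - 1).toNat) hx
    rw [chargeB_single_inr] at h
    rwa [show l + 1 = ((1 : ℕ) : ℤ) + l by push_cast; ring]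

lemma nbg_mem_MM {l : ℤ} (j k : ℤ) {x : FockB} (hx : x ∈ MM l) : nbg j k x ∈ MM l := by
  unfold nbg
  split_ifs
  · simpa using gammaOp_mem_MM k (betaOp_mem_MM j hx)
  · simpa using betaOp_mem_MM j (gammaOp_mem_MM k hx)

lemma Jmode_mem_MM (s : ℂ) (N : ℕ) (m : ℤ) {l : ℤ} {x : FockB} (hx : x ∈ MM l) :
    Jmode s N m x ∈ MM l := by
  refine Submodule.add_mem _ ?_ ?_
  · exact finsum_induction (· ∈ MM l) (zero_mem _) (fun _ _ => add_mem)
      fun j => Submodule.smul_mem _ _ (nbg_mem_MM _ _ hx)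
  · split_ifs
    · exact Submodule.smul_mem _ _ hx
    · exact zero_mem _

lemma nbg_inl_inl (a b : ℕ) (x : FockB) :
    nbg (-(a : ℤ)) b x = X (Sum.inl a) * pderiv (Sum.inl b) x := by
  have h : ¬ (1 ≤ -(a : ℤ) ∧ (b : ℤ) ≤ -1) := by omega
  simp [nbg, h, betaOp, gammaOp]

lemma nbg_inr_inr (a b : ℕ) (x : FockB) :
    nbg (a + 1) (-(b + 1)) x = -(X (Sum.inr b) * pderiv (Sum.inr a) x) := by
  have h : 1 ≤ (a : ℤ) + 1 ∧ -((b : ℤ) + 1) ≤ -1 := by omega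
  have h1 : ¬ (a : ℤ) + 1 ≤ 0 := by omega
  have h2 : ¬ 0 ≤ -((b : ℤ) + 1) := by omega
  rw [nbg, if_pos h, betaOp, gammaOp, if_neg h1, if_neg h2]
  simp

lemma nbg_inl_inr (a b : ℕ) (x : FockB) :
    nbg (-(a : ℤ)) (-(b + 1)) x = X (Sum.inl a) * (X (Sum.inr b) * x) := by
  have h : ¬ (1 ≤ -(a : ℤ) ∧ -((b : ℤ) + 1) ≤ -1) := by omega
  have h1 : -(a : ℤ) ≤ 0 := by omega
  have h2 : ¬ 0 ≤ -((b : ℤ) + 1) := by omega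
  rw [nbg, if_neg h, betaOp, gammaOp, if_pos h1, if_neg h2]
  simp

lemma nbg_inr_inl (a b : ℕ) (x : FockB) :
    nbg (a + 1) b x = -(pderiv (Sum.inr a) (pderiv (Sum.inl b) x)) := by
  have h : ¬ (1 ≤ (a : ℤ) + 1 ∧ (b : ℤ) ≤ -1) := by omega
  have h1 : ¬ (a : ℤ) + 1 ≤ 0 := by omega
  rw [nbg, if_neg h, betaOp, gammaOp, if_neg h1, if_pos (by omega)]
  simp

lemma finite_support_nbg (m : ℤ) (x : FockB) :
    (Function.support fun j : ℤ => nbg j (m - j) x).Finite := by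
  refine (((x.vars.finite_toSet.image
      (Sum.elim (fun a : ℕ => m - a) fun a : ℕ => (a : ℤ) + 1)).union
      (Set.finite_Icc (m + 1) 0))).subset fun j hj => ?_
  rw [Function.mem_support] at hj
  by_cases hk : 0 ≤ m - j
  · left
    obtain ⟨b, hb⟩ := Int.eq_ofNat_of_zero_le hk
    refine ⟨Sum.inl b, ?_, by simp; omega⟩
    by_contra hv
    refine hj ?_
    rw [nbg, if_neg (by omega), gammaOp, if_pos hk, hb]
    simp [pderiv_eq_zero_of_notMem_vars hv]
  · by_cases h1 : 1 ≤ j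
    · left
      obtain ⟨b, hb⟩ := Int.eq_ofNat_of_zero_le (show 0 ≤ j - 1 by omega)
      refine ⟨Sum.inr b, ?_, by simp; omega⟩
      by_contra hv
      refine hj ?_
      rw [nbg, if_pos (by omega), betaOp, if_neg (by omega), hb]
      simp [pderiv_eq_zero_of_notMem_vars hv]
    · right
      constructor <;> omega

/-- The falling products `∏_{i<N} (s - X - i)` span the polynomial ring. -/
lemma span_range_prod_sub (s : ℂ) :
    Submodule.span ℂ (Set.range fun N : ℕ =>
      ∏ i ∈ Finset.range N, (Polynomial.C s - Polynomial.X - Polynomial.C (i : ℂ))) = ⊤ := by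
  set W := Submodule.span ℂ (Set.range fun N : ℕ =>
      ∏ i ∈ Finset.range N, (Polynomial.C s - Polynomial.X - Polynomial.C (i : ℂ)))
  have hX : ∀ g ∈ W, g * Polynomial.X ∈ W := by
    intro g hg
    induction hg using Submodule.span_induction with
    | mem g h =>
      obtain ⟨N, rfl⟩ := h
      have h0 := Submodule.smul_mem W (s - N) (Submodule.subset_span ⟨N, rfl⟩)
      have h1 : _ ∈ W := Submodule.subset_span ⟨N + 1, rfl⟩
      convert Submodule.sub_mem _ h0 h1 using 1
      simp only [Finset.prod_range_succ, Polynomial.smul_eq_C_mul, map_sub]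
      ring
    | zero => simp
    | add x y _ _ hx hy => rw [add_mul]; exact add_mem hx hy
    | smul a x _ hx => rw [smul_mul_assoc]; exact Submodule.smul_mem _ _ hx
  have h1 : (1 : Polynomial ℂ) ∈ W := Submodule.subset_span ⟨0, by simp⟩
  have hpow : ∀ n : ℕ, (Polynomial.X ^ n : Polynomial ℂ) ∈ W := by
    intro n
    induction n with
    | zero => simpa using h1
    | succ n ih => rw [pow_succ]; exact hX _ ih
  refine eq_top_iff.2 fun f _ => ?_
  rw [f.as_sum_range_C_mul_X_pow]
  refine Submodule.sum_mem _ fun n _ => ?_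
  rw [← Polynomial.smul_eq_C_mul]
  exact Submodule.smul_mem _ _ (hpow n)

/-- A submodule invariant under all `J^N_m` is invariant under all `:β(j)γ(k):`. -/
lemma nbg_mem_of_Jmode_mem {s : ℂ} {U : Submodule ℂ FockB}
    (hU : ∀ (N : ℕ) (m : ℤ), ∀ x ∈ U, Jmode s N m x ∈ U) (j k : ℤ) {x : FockB} (hx : x ∈ U) :
    nbg j k x ∈ U := by
  obtain ⟨m, rfl⟩ : ∃ m, k = m - j := ⟨k + j, by ring⟩
  have hfin := finite_support_nbg m x
  let T := hfin.toFinset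
  let L : Polynomial ℂ →ₗ[ℂ] FockB :=
    ∑ i ∈ T, (Polynomial.leval (i : ℂ)).smulRight (nbg i (m - i) x)
  have hL : ∀ f, L f = ∑ i ∈ T, f.eval (i : ℂ) • nbg i (m - i) x := fun f => by
    simp [L, LinearMap.sum_apply]
  have hLU : ⊤ ≤ U.comap L := by
    rw [← span_range_prod_sub s, Submodule.span_le]
    rintro _ ⟨N, rfl⟩
    rw [SetLike.mem_coe, Submodule.mem_comap, hL]
    have hJ := hU N m x hx
    have hc : (if m = 0 then
        ((1 / ((N : ℂ) + 1)) * ∏ i ∈ Finset.range (N + 1), (s - (i : ℂ))) • x else 0) ∈ U := by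
      split_ifs
      · exact Submodule.smul_mem _ _ hx
      · exact zero_mem _
    rw [Jmode, Submodule.add_mem_iff_left _ hc,
      finsum_eq_sum_of_support_subset (s := T)] at hJ
    · simpa [Polynomial.eval_prod] using hJ
    · intro i hi
      simp only [T, Set.Finite.coe_toFinset, Function.mem_support] at hi ⊢
      exact fun h => hi (by rw [h, smul_zero])
  by_cases hj : j ∈ T
  · have h := hLU (x := ∏ i ∈ T.erase j, (Polynomial.X - Polynomial.C (i : ℂ))) trivial
    rw [Submodule.mem_comap, hL, Finset.sum_eq_single_of_mem j hj] at h
    · refine (Submodule.smul_mem_iff _ ?_).1 h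
      rw [Polynomial.eval_prod, Finset.prod_ne_zero_iff]
      intro i hi
      have : j ≠ i := (Finset.ne_of_mem_erase hi).symm
      simpa [sub_eq_zero] using this
    · intro i hi hij
      rw [Polynomial.eval_prod, Finset.prod_eq_zero (Finset.mem_erase.2 ⟨hij, hi⟩) (by simp),
        zero_smul]
  · have : nbg j (m - j) x = 0 := by simpa [T] using hj
    rw [this]
    exact zero_mem _

lemma X_mul_pderiv_mem {U : Submodule ℂ FockB} (hU : ∀ j k : ℤ, ∀ x ∈ U, nbg j k x ∈ U)
    (i : ℕ ⊕ ℕ) {x : FockB} (hx : x ∈ U) : X i * pderiv i x ∈ U := by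
  rcases i with a | a
  · simpa [nbg_inl_inl] using hU (-(a : ℤ)) a x hx
  · have := hU (a + 1) (-(a + 1)) x hx
    rwa [nbg_inr_inr, neg_mem_iff] at this

lemma coeff_X_mul_pderiv (i : ℕ ⊕ ℕ) (d : (ℕ ⊕ ℕ) →₀ ℕ) (x : FockB) :
    coeff d (X i * pderiv i x) = (d i : ℂ) * coeff d x := by
  induction x using MvPolynomial.induction_on' with
  | monomial e a =>
    rw [X_mul_pderiv_monomial, coeff_smul, coeff_monomial]
    split_ifs with h
    · simp [h]
    · simp
  | add p q hp hq => simp [mul_add, hp, hq]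

/-- A nonzero submodule invariant under the Euler operators `X i * ∂/∂X i` contains a
monomial. -/
lemma exists_monomial_mem {U : Submodule ℂ FockB}
    (hU : ∀ i, ∀ x ∈ U, X i * pderiv i x ∈ U) (hne : U ≠ ⊥) :
    ∃ d, monomial d (1 : ℂ) ∈ U := by
  obtain ⟨u, hu, hu0⟩ := Submodule.exists_mem_ne_zero_of_ne_bot hne
  induction hn : u.support.card using Nat.strong_induction_on generalizing u with
  | _ n ih =>
    obtain ⟨d, hd⟩ := ne_zero_iff.1 hu0
    by_cases hall : ∀ e, coeff e u ≠ 0 → e = d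
    · refine ⟨d, (Submodule.smul_mem_iff U hd).1 ?_⟩
      convert hu
      ext e
      rw [smul_monomial, coeff_monomial]
      split_ifs with h
      · simp [h]
      · by_contra h'
        exact h (hall e (Ne.symm h')).symm
    · push Not at hall
      obtain ⟨e, he, hed⟩ := hall
      obtain ⟨i, hi⟩ := DFunLike.ne_iff.1 hed
      have hcoeff : ∀ f, coeff f (X i * pderiv i u - (d i : ℂ) • u) =
          ((f i : ℂ) - d i) * coeff f u := fun f => by
        rw [coeff_sub, coeff_X_mul_pderiv, coeff_smul, smul_eq_mul]; ring
      refine ih _ ?_ _ (sub_mem (hU i u hu) (Submodule.smul_mem _ (d i : ℂ) hu)) ?_ rfl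
      · rw [← hn]
        refine Finset.card_lt_card (Finset.ssubset_iff_of_subset ?_ |>.2 ⟨d, ?_, ?_⟩)
        · intro f
          simp only [mem_support_iff, hcoeff]
          exact right_ne_zero_of_mul
        · simpa using hd
        · simp [hcoeff]
      · refine ne_zero_iff.2 ⟨e, ?_⟩
        rw [hcoeff]
        refine mul_ne_zero ?_ he
        simpa [sub_eq_zero] using hi

/-- The syntactic congruence of the set of exponents of monomials lying in `U`. -/
def monomialCon (U : Submodule ℂ FockB) : AddCon ((ℕ ⊕ ℕ) →₀ ℕ) where
  r d e := ∀ c, monomial (d + c) (1 : ℂ) ∈ U ↔ monomial (e + c) (1 : ℂ) ∈ U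
  iseqv := ⟨fun _ _ => Iff.rfl, fun h c => (h c).symm, fun h h' c => (h c).trans (h' c)⟩
  add' {d e d' e'} h h' c := by
    rw [add_assoc, h, add_left_comm, h', add_left_comm, add_assoc]

lemma monomialCon_inl_inl {U : Submodule ℂ FockB} (hU : ∀ j k : ℤ, ∀ x ∈ U, nbg j k x ∈ U)
    (a b : ℕ) :
    monomialCon U (Finsupp.single (Sum.inl a) 1) (Finsupp.single (Sum.inl b) 1) := by
  have key : ∀ (a b : ℕ) c, monomial (Finsupp.single (Sum.inl a) 1 + c) (1 : ℂ) ∈ U →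
      monomial (Finsupp.single (Sum.inl b) 1 + c) (1 : ℂ) ∈ U := by
    intro a b c h
    have := hU (-(b : ℤ)) a _ h
    rwa [nbg_inl_inl, pderiv_monomial_single_add, mul_smul_comm, X_mul_monomial_one,
      Submodule.smul_mem_iff _ (Nat.cast_add_one_ne_zero _)] at this
  exact fun c => ⟨key a b c, key b a c⟩

lemma monomialCon_inr_inr {U : Submodule ℂ FockB} (hU : ∀ j k : ℤ, ∀ x ∈ U, nbg j k x ∈ U)
    (a b : ℕ) :
    monomialCon U (Finsupp.single (Sum.inr a) 1) (Finsupp.single (Sum.inr b) 1) := by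
  have key : ∀ (a b : ℕ) c, monomial (Finsupp.single (Sum.inr a) 1 + c) (1 : ℂ) ∈ U →
      monomial (Finsupp.single (Sum.inr b) 1 + c) (1 : ℂ) ∈ U := by
    intro a b c h
    have := hU (a + 1) (-(b + 1)) _ h
    rwa [nbg_inr_inr, neg_mem_iff, pderiv_monomial_single_add, mul_smul_comm, X_mul_monomial_one,
      Submodule.smul_mem_iff _ (Nat.cast_add_one_ne_zero _)] at this
  exact fun c => ⟨key a b c, key b a c⟩

lemma monomialCon_inl_add_inr {U : Submodule ℂ FockB}
    (hU : ∀ j k : ℤ, ∀ x ∈ U, nbg j k x ∈ U) (a b : ℕ) :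
    monomialCon U (Finsupp.single (Sum.inl a) 1 + Finsupp.single (Sum.inr b) 1) 0 := by
  refine fun c => ⟨fun h => ?_, fun h => ?_⟩
  · have := hU (b + 1) a _ h
    rwa [nbg_inr_inl, neg_mem_iff, add_assoc, pderiv_monomial_single_add, Derivation.map_smul,
      pderiv_monomial_single_add, Submodule.smul_mem_iff _ (Nat.cast_add_one_ne_zero _),
      Submodule.smul_mem_iff _ (Nat.cast_add_one_ne_zero _), ← zero_add c] at this
  · rw [zero_add] at h
    have := hU (-(a : ℤ)) (-(b + 1)) _ h
    rwa [nbg_inl_inr, X_mul_monomial_one, X_mul_monomial_one, ← add_assoc] at this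

/-- Exponents of equal charge are congruent. -/
lemma monomialCon_of_chargeB_eq {U : Submodule ℂ FockB}
    (hU : ∀ j k : ℤ, ∀ x ∈ U, nbg j k x ∈ U) {d e : (ℕ ⊕ ℕ) →₀ ℕ}
    (h : chargeB d = chargeB e) : monomialCon U d e := by
  let π := (monomialCon U).mk'
  let A := π (Finsupp.single (Sum.inl 0) 1)
  let B := π (Finsupp.single (Sum.inr 0) 1)
  have hA : ∀ a, π (Finsupp.single (Sum.inl a) 1) = A := fun a =>
    (AddCon.eq _).2 (monomialCon_inl_inl hU a 0)
  have hB : ∀ a, π (Finsupp.single (Sum.inr a) 1) = B := fun a =>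
    (AddCon.eq _).2 (monomialCon_inr_inr hU a 0)
  have hAB : A + B = 0 := (AddCon.eq _).2 (monomialCon_inl_add_inr hU 0 0)
  have hπ : ∀ d, ∃ p q : ℕ, chargeB d = q - p ∧ π d = p • A + q • B := by
    intro d
    induction d using Finsupp.induction_linear with
    | zero => exact ⟨0, 0, by simp [chargeB], by simp⟩
    | add f g hf hg =>
      obtain ⟨p, q, h1, h2⟩ := hf
      obtain ⟨p', q', h1', h2'⟩ := hg
      refine ⟨p + p', q + q', ?_, ?_⟩
      · rw [chargeB_add, h1, h1']; push_cast; ring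
      · rw [map_add, h2, h2', add_nsmul, add_nsmul, add_add_add_comm]
    | single i n =>
      have hn : Finsupp.single i n = n • Finsupp.single i 1 := by simp
      rcases i with a | a
      · exact ⟨n, 0, by simp [chargeB_single_inl], by rw [hn, map_nsmul, hA]; simp⟩
      · exact ⟨0, n, by simp [chargeB_single_inr], by rw [hn, map_nsmul, hB]; simp⟩
  have hshift : ∀ p q k : ℕ, (p + k) • A + (q + k) • B = p • A + q • B := fun p q k => by
    rw [add_nsmul, add_nsmul, add_add_add_comm, ← nsmul_add, hAB, nsmul_zero, add_zero]
  obtain ⟨p, q, hd, hd'⟩ := hπ d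
  obtain ⟨p', q', he, he'⟩ := hπ e
  refine (AddCon.eq _).1 (show π d = π e from ?_)
  rw [hd', he']
  rcases le_total p p' with hp | hp
  · obtain ⟨k, rfl⟩ := Nat.exists_eq_add_of_le hp
    obtain rfl : q' = q + k := by omega
    exact (hshift p q k).symm
  · obtain ⟨k, rfl⟩ := Nat.exists_eq_add_of_le hp
    obtain rfl : q = q' + k := by omega
    exact hshift p' q' k

/-- `M^l` is an irreducible module over `W_{1+∞}` with central charge `−1`. -/
theorem Ml_invariant_and_irreducible (s : ℂ) (l : ℤ) :
    (∀ (N : ℕ) (m : ℤ), ∀ x ∈ MM l, Jmode s N m x ∈ MM l) ∧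
    (∀ U : Submodule ℂ FockB, U ≤ MM l → U ≠ ⊥ →
      (∀ (N : ℕ) (m : ℤ), ∀ x ∈ U, Jmode s N m x ∈ U) → U = MM l) := by
  refine ⟨fun N m x hx => Jmode_mem_MM s N m hx, fun U hUl hne hJ => ?_⟩
  have hU : ∀ j k : ℤ, ∀ x ∈ U, nbg j k x ∈ U := fun j k x hx => nbg_mem_of_Jmode_mem hJ j k hx
  obtain ⟨d, hd⟩ := exists_monomial_mem (fun i x hx => X_mul_pderiv_mem hU i hx) hne
  have hdl : chargeB d = l := chargeB_eq_of_coeff_ne_zero (hUl hd) (d := d) (by simp)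
  refine le_antisymm hUl (Submodule.span_le.2 ?_)
  rintro _ ⟨e, he, rfl⟩
  have := (monomialCon_of_chargeB_eq hU (hdl.trans he.symm) 0).1
  simp only [add_zero] at this
  exact this hd
end
end

section
/- Let F be the fermionic Fock space of the bc-system, with operators b(n), c(n) and Virasoro modes L_m defined in the context. Then for all m, n ∈ ℤ, as operators on F: L_m ∘ b(n) − b(n) ∘ L_m = −(m + n)·b(m+n) and L_m ∘ c(n) − c(n) ∘ L_m = −n·c(m+n). (These are the mode forms of the operator product expansions T(z)b(w) ∼ ∂b(w)/(z−w) and T(z)c(w) ∼ c(w)/(z−w)² + ∂c(w)/(z−w).) -/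
noncomputable section

open ExteriorAlgebra

/-- Index type for the basis of `V`: `Sum.inl n` corresponds to `v_n` (`n ≥ 0`),
and `Sum.inr n` corresponds to `w_{n+1}` (so the `w_k` for `k ≥ 1`). -/
abbrev BCIndex : Type := ℕ ⊕ ℕ

/-- The vector space `V` with basis `{v_n : n ≥ 0} ∪ {w_n : n ≥ 1}`. -/
abbrev BCSpace : Type := BCIndex →₀ ℂ

/-- The fermionic Fock space: the exterior algebra of `V`. -/
abbrev FockF : Type := ExteriorAlgebra ℂ BCSpace

/-- The basis vector of `V` with index `i`. -/
def bv (i : BCIndex) : BCSpace := Finsupp.single i 1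

/-- The linear functional sending the basis vector `i` to `1` and all others to `0`. -/
def bvDual (i : BCIndex) : Module.Dual ℂ BCSpace := Finsupp.lapply i

/-- The operator `b(n)`: for `n ≤ 0` left exterior multiplication by `v_{-n}`,
for `n ≥ 1` contraction with the functional dual to `w_n`. -/
def bOp (n : ℤ) : Module.End ℂ FockF :=
  if n ≤ 0 then LinearMap.mulLeft ℂ (ι ℂ (bv (Sum.inl (-n).toNat)))
  else CliffordAlgebra.contractLeft (bvDual (Sum.inr (n - 1).toNat))

/-- The operator `c(n)`: for `n ≥ 0` contraction with the functional dual to `v_n`,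
for `n ≤ -1` left exterior multiplication by `w_{-n}`. -/
def cOp (n : ℤ) : Module.End ℂ FockF :=
  if 0 ≤ n then CliffordAlgebra.contractLeft (bvDual (Sum.inl n.toNat))
  else LinearMap.mulLeft ℂ (ι ℂ (bv (Sum.inr (-n - 1).toNat)))

/-- The normally ordered product `:b(k)c(j):`. -/
def nbc (k j : ℤ) : Module.End ℂ FockF :=
  if 1 ≤ k ∧ j ≤ -1 then -(cOp j ∘ₗ bOp k) else bOp k ∘ₗ cOp j

/-- The Virasoro modes `L_m` of `T(z) = :∂b(z)c(z):`,
`L_m x = Σ_k (−k)·:b(k)c(m−k):·x` (a finite sum on each `x`). -/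
def Lmode (m : ℤ) (x : FockF) : FockF :=
  ∑ᶠ k : ℤ, (-k : ℂ) • nbc k (m - k) x

/-- The modes `W̃_m` of `W̃(z) = (1/2)(:∂²b(z)c(z): − :∂b(z)∂c(z):)`,
`W̃_m x = (1/2)Σ_k k(2k−m)·:b(k)c(m−k):·x` (a finite sum on each `x`). -/
def Wmode (m : ℤ) (x : FockF) : FockF :=
  ∑ᶠ k : ℤ, ((1 / 2 : ℂ) * k * (2 * k - m)) • nbc k (m - k) x

/-- The charge of a list of basis indices: (number of `v`-type) − (number of `w`-type). -/
def chargeOf (L : List BCIndex) : ℤ :=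
  (L.countP Sum.isLeft : ℤ) - (L.countP Sum.isRight : ℤ)

/-- `F^l`: the span of the wedge monomials of charge `l`. -/
def FF (l : ℤ) : Submodule ℂ FockF :=
  Submodule.span ℂ
    {x | ∃ L : List BCIndex, chargeOf L = l ∧ x = (L.map fun i => ι ℂ (bv i)).prod}

/-- `F̄^l = {x ∈ F^l : c(0)x = 0}`. -/
def FFbar (l : ℤ) : Submodule ℂ FockF := FF l ⊓ LinearMap.ker (cOp 0)

/-- The contraction of a generator multiplied from the left. -/
theorem contractLeft_bvDual_bv_mul (i j : BCIndex) (x : FockF) :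
    CliffordAlgebra.contractLeft (bvDual i) (ι ℂ (bv j) * x) =
      (if j = i then x else 0) -
        ι ℂ (bv j) * CliffordAlgebra.contractLeft (bvDual i) x := by
  refine (CliffordAlgebra.contractLeft_ι_mul (Q := (0 : QuadraticForm ℂ BCSpace))
    (bvDual i) (bv j) x).trans ?_
  by_cases h : j = i <;> simp [bv, bvDual, h, ExteriorAlgebra.ι]

theorem ι_mul_ι_mul_add_swap (u v : BCSpace) (x : FockF) :
    ι ℂ u * (ι ℂ v * x) + ι ℂ v * (ι ℂ u * x) = 0 := by
  rw [← mul_assoc, ← mul_assoc, ← add_mul, ι_add_mul_swap, zero_mul]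

theorem contractLeft_contractLeft_add_swap (d d' : Module.Dual ℂ BCSpace) (x : FockF) :
    CliffordAlgebra.contractLeft d (CliffordAlgebra.contractLeft d' x) +
      CliffordAlgebra.contractLeft d' (CliffordAlgebra.contractLeft d x) = 0 := by
  rw [CliffordAlgebra.contractLeft_comm, neg_add_cancel]

theorem bOp_bOp_add_swap (m n : ℤ) (x : FockF) :
    bOp m (bOp n x) + bOp n (bOp m x) = 0 := by
  by_cases hm : m ≤ 0 <;> by_cases hn : n ≤ 0 <;>
    simp only [bOp, hm, hn, if_true, if_false, LinearMap.mulLeft_apply,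
      contractLeft_bvDual_bv_mul, ι_mul_ι_mul_add_swap, contractLeft_contractLeft_add_swap,
      reduceCtorEq] <;> abel

theorem cOp_cOp_add_swap (m n : ℤ) (x : FockF) :
    cOp m (cOp n x) + cOp n (cOp m x) = 0 := by
  by_cases hm : 0 ≤ m <;> by_cases hn : 0 ≤ n <;>
    simp only [cOp, hm, hn, if_true, if_false, LinearMap.mulLeft_apply,
      contractLeft_bvDual_bv_mul, ι_mul_ι_mul_add_swap, contractLeft_contractLeft_add_swap,
      reduceCtorEq] <;> abel

theorem bOp_cOp_add_swap (m n : ℤ) (x : FockF) :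
    bOp m (cOp n x) + cOp n (bOp m x) = if m = -n then x else 0 := by
  by_cases hm : m ≤ 0 <;> by_cases hn : 0 ≤ n <;>
    simp only [bOp, cOp, hm, hn, if_true, if_false, LinearMap.mulLeft_apply,
      contractLeft_bvDual_bv_mul, ι_mul_ι_mul_add_swap, contractLeft_contractLeft_add_swap,
      Sum.inl.injEq, Sum.inr.injEq]
  · have : (-m).toNat = n.toNat ↔ m = -n := by omega
    simp only [this]; abel
  · rw [if_neg (by omega)]
  · rw [if_neg (by omega)]
  · have : (-n - 1).toNat = (m - 1).toNat ↔ m = -n := by omega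
    simp only [this]; abel

/-- Every vector is annihilated by all but finitely many of the dual contractions. -/
theorem finite_contractLeft_ne_zero (x : FockF) :
    {i | CliffordAlgebra.contractLeft (bvDual i) x ≠ 0}.Finite := by
  induction x using CliffordAlgebra.left_induction with
  | algebraMap r => simp [CliffordAlgebra.contractLeft_algebraMap]
  | add x y hx hy =>
    refine (hx.union hy).subset fun i hi => ?_
    by_contra h
    simp only [Set.mem_union, Set.mem_ofPred_eq, not_or, not_not] at h
    exact hi (by rw [map_add, h.1, h.2, add_zero])
  | ι_mul x v hx =>
    refine (hx.union v.support.finite_toSet).subset fun i hi => ?_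
    by_contra h
    simp only [Set.mem_union, Set.mem_ofPred_eq, not_or, not_not, Finset.mem_coe,
      Finsupp.mem_support_iff] at h
    refine hi ?_
    rw [CliffordAlgebra.contractLeft_ι_mul, h.1, mul_zero, sub_zero]
    simp [bvDual, h.2]

theorem exists_forall_ge_bOp_cOp_eq_zero (x : FockF) :
    ∃ N : ℤ, ∀ n, N ≤ n → bOp n x = 0 ∧ cOp n x = 0 := by
  have hx := finite_contractLeft_ne_zero x
  obtain ⟨A, hA⟩ := (hx.preimage Sum.inl_injective.injOn).bddAbove
  obtain ⟨B, hB⟩ := (hx.preimage Sum.inr_injective.injOn).bddAbove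
  refine ⟨A + B + 2, fun n hn => ⟨?_, ?_⟩⟩
  · rw [bOp, if_neg (by omega)]
    by_contra h
    have : (n - 1).toNat ≤ B := hB h
    omega
  · rw [cOp, if_pos (by omega)]
    by_contra h
    have : n.toNat ≤ A := hA h
    omega

theorem finite_support_Lmode (m : ℤ) (x : FockF) :
    (Function.support fun k : ℤ => (-k : ℂ) • nbc k (m - k) x).Finite := by
  obtain ⟨N, hN⟩ := exists_forall_ge_bOp_cOp_eq_zero x
  refine (Set.finite_Icc (-(|N| + |m| + 1)) (|N| + |m| + 1)).subset fun k hk => ?_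
  by_contra h
  refine hk ?_
  have hN' := le_abs_self N
  have hm := le_abs_self m
  have hm' := neg_abs_le m
  have hN0 := abs_nonneg N
  rw [Set.mem_Icc, not_and_or] at h
  rcases h with h | h
  · have h' : ¬ (1 ≤ k ∧ m - k ≤ -1) := by omega
    simp only [nbc, if_neg h', LinearMap.comp_apply, (hN (m - k) (by omega)).2, map_zero,
      smul_zero]
  · have h' : 1 ≤ k ∧ m - k ≤ -1 := by omega
    simp only [nbc, if_pos h', LinearMap.neg_apply, LinearMap.comp_apply,
      (hN k (by omega)).1, map_zero, neg_zero, smul_zero]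

theorem nbc_apply (k j : ℤ) (x : FockF) :
    nbc k j x = bOp k (cOp j x) - if 1 ≤ k ∧ j ≤ -1 ∧ k = -j then x else 0 := by
  have h := bOp_cOp_add_swap k j x
  by_cases h1 : 1 ≤ k ∧ j ≤ -1
  · simp only [nbc, h1, and_self, if_true, true_and, ← h, LinearMap.neg_apply,
      LinearMap.comp_apply]
    abel
  · rw [nbc, if_neg h1, if_neg (by tauto), sub_zero, LinearMap.comp_apply]

theorem nbc_bOp_sub (k j n : ℤ) (x : FockF) :
    nbc k j (bOp n x) - bOp n (nbc k j x) = if n = -j then bOp k x else 0 := by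
  have h1 := congrArg (bOp k) (bOp_cOp_add_swap n j x)
  have h2 := bOp_bOp_add_swap k n (cOp j x)
  rw [map_add, apply_ite (bOp k), map_zero] at h1
  rw [nbc_apply, nbc_apply, map_sub, apply_ite (bOp n), map_zero, ← h1,
    eq_neg_of_add_eq_zero_left h2]
  abel

theorem nbc_cOp_sub (k j n : ℤ) (x : FockF) :
    nbc k j (cOp n x) - cOp n (nbc k j x) = if k = -n then -cOp j x else 0 := by
  have h1 := bOp_cOp_add_swap k n (cOp j x)
  have h2 := congrArg (bOp k) (eq_neg_of_add_eq_zero_left (cOp_cOp_add_swap j n x))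
  have h3 : (if k = -n then -cOp j x else 0) = -(if k = -n then cOp j x else 0) := by
    split_ifs <;> simp
  rw [nbc_apply, nbc_apply, map_sub, apply_ite (cOp n), map_zero, h3, ← h1, h2, map_neg]
  abel

theorem Lmode_apply_sub (m : ℤ) (T : Module.End ℂ FockF) (x : FockF) :
    Lmode m (T x) - T (Lmode m x) =
      ∑ᶠ k : ℤ, (-k : ℂ) • (nbc k (m - k) (T x) - T (nbc k (m - k) x)) := by
  have hx := finite_support_Lmode m x
  have hT : T (Lmode m x) = ∑ᶠ k : ℤ, T ((-k : ℂ) • nbc k (m - k) x) :=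
    T.toAddMonoidHom.map_finsum hx
  rw [hT, Lmode, ← finsum_sub_distrib (finite_support_Lmode m (T x))]
  · simp only [map_smul, smul_sub]
  · exact hx.subset (Function.support_comp_subset (map_zero T) _)

/-- Mode form of the OPEs `T(z)b(w) ∼ ∂b(w)/(z−w)` and
`T(z)c(w) ∼ c(w)/(z−w)² + ∂c(w)/(z−w)`:
`[L_m, b(n)] = −(m+n)·b(m+n)` and `[L_m, c(n)] = −n·c(m+n)`. -/
theorem L_b_c_commutators (m n : ℤ) (x : FockF) :
    Lmode m (bOp n x) - bOp n (Lmode m x) = (-(m + n : ℤ) : ℂ) • bOp (m + n) x ∧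
    Lmode m (cOp n x) - cOp n (Lmode m x) = (-(n : ℂ)) • cOp (m + n) x := by
  constructor
  · rw [Lmode_apply_sub, finsum_eq_single _ (m + n)]
    · rw [nbc_bOp_sub, if_pos (by ring)]
    · intro k hk
      rw [nbc_bOp_sub, if_neg (by omega), smul_zero]
  · rw [Lmode_apply_sub, finsum_eq_single _ (-n)]
    · rw [nbc_cOp_sub, if_pos rfl, sub_neg_eq_add]
      simp
    · intro k hk
      rw [nbc_cOp_sub, if_neg hk, smul_zero]
end
end

section
/- Let F be the fermionic Fock space of the bc-system with the operators L_0 and W̃_0 and subspaces F^l defined in the context. For every l ∈ ℤ, every natural number N and every integer M, the complex dimension of the joint eigenspace {x ∈ F^l : L_0 x = N·x and W̃_0 x = M·x} equals the number of pairs (A, B) where A is a finite set of nonnegative integers and B is a finite set of positive integers such that |A| − |B| = l, Σ_{a∈A} a + Σ_{b∈B} b = N, and Σ_{a∈A} a² − Σ_{b∈B} b² = M. (This is the statement that Tr_{⊕_l F^l} z^{−j₀} q^{L_0} p^{W̃_0} = (1 + z)·∏_{n≥1}(1 + z q^n p^{n²})(1 + z^{−1} q^n p^{−n²}).) -/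
noncomputable section

open ExteriorAlgebra

/-- The zero mode `L_0 x = Σ_k (−k)·:b(k)c(−k):·x` of `T(z)`. -/
def Lzero (x : FockF) : FockF := ∑ᶠ k : ℤ, (-k : ℂ) • nbc k (-k) x

/-- The zero mode `W̃_0 x = Σ_k k²·:b(k)c(−k):·x` of `W̃(z)`. -/
def Wzero (x : FockF) : FockF := ∑ᶠ k : ℤ, ((k : ℂ) ^ 2) • nbc k (-k) x

/-- The wedge monomial attached to a list of basis indices. -/
def wedgeList (L : List BCIndex) : FockF := (L.map fun i => ι ℂ (bv i)).prod

/-- The wedge monomial attached to a finite set of basis indices, up to a choice of ordering. -/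
def wedge (S : Finset BCIndex) : FockF := wedgeList S.toList

/-- The number operator of the mode `i`. -/
def numberOp (i : BCIndex) : Module.End ℂ FockF :=
  LinearMap.mulLeft ℂ (ι ℂ (bv i)) ∘ₗ CliffordAlgebra.contractLeft (bvDual i)

theorem wedgeList_cons (i : BCIndex) (L : List BCIndex) :
    wedgeList (i :: L) = ι ℂ (bv i) * wedgeList L := by
  simp [wedgeList]

theorem wedgeList_perm {L L' : List BCIndex} (h : L.Perm L') :
    wedgeList L = wedgeList L' ∨ wedgeList L = -wedgeList L' := by
  induction h with
  | nil => exact Or.inl rfl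
  | cons i _ ih =>
    rw [wedgeList_cons, wedgeList_cons]
    rcases ih with ih | ih <;> simp [ih]
  | swap i j L =>
    right
    have h : ι ℂ (bv j) * ι ℂ (bv i) = -(ι ℂ (bv i) * ι ℂ (bv j)) :=
      eq_neg_of_add_eq_zero_left (ι_add_mul_swap _ _)
    simp only [wedgeList_cons, ← mul_assoc, h, neg_mul]
  | trans _ _ ih ih' =>
    rcases ih with ih | ih <;> rcases ih' with ih' | ih' <;> simp [ih, ih']

theorem wedgeList_eq_zero {L : List BCIndex} (h : ¬ L.Nodup) : wedgeList L = 0 := by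
  obtain ⟨i, hi⟩ := List.exists_duplicate_iff_not_nodup.mpr h
  obtain ⟨L', hL⟩ : ∃ L', L.Perm (i :: i :: L') :=
    (List.duplicate_iff_sublist.mp hi).exists_perm_append
  have h0 : wedgeList (i :: i :: L') = 0 := by
    rw [wedgeList_cons, wedgeList_cons, ← mul_assoc, ι_sq_zero, zero_mul]
  rcases wedgeList_perm hL with h | h <;> simp [h, h0]

theorem contractLeft_wedgeList_cons (i j : BCIndex) (L : List BCIndex) :
    CliffordAlgebra.contractLeft (bvDual i) (wedgeList (j :: L)) =
      (if j = i then (1 : ℂ) else 0) • wedgeList L -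
        ι ℂ (bv j) * CliffordAlgebra.contractLeft (bvDual i) (wedgeList L) := by
  rw [wedgeList_cons]
  refine (CliffordAlgebra.contractLeft_ι_mul _ _ _).trans ?_
  simp [bvDual, bv, Finsupp.single_apply]

theorem contractLeft_wedgeList_of_notMem {i : BCIndex} {L : List BCIndex} (h : i ∉ L) :
    CliffordAlgebra.contractLeft (bvDual i) (wedgeList L) = 0 := by
  induction L with
  | nil => exact CliffordAlgebra.contractLeft_one _ _
  | cons j L ih =>
    rw [List.mem_cons, not_or] at h
    rw [contractLeft_wedgeList_cons, ih h.2, if_neg (Ne.symm h.1)]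
    simp

theorem contractLeft_wedgeList_cons_self {i : BCIndex} {L : List BCIndex} (h : i ∉ L) :
    CliffordAlgebra.contractLeft (bvDual i) (wedgeList (i :: L)) = wedgeList L := by
  rw [contractLeft_wedgeList_cons, contractLeft_wedgeList_of_notMem h]
  simp

theorem wedgeList_ne_zero {L : List BCIndex} (h : L.Nodup) : wedgeList L ≠ 0 := by
  induction L with
  | nil => simp [wedgeList]
  | cons i L ih =>
    rw [List.nodup_cons] at h
    intro h0
    apply ih h.2
    rw [← contractLeft_wedgeList_cons_self h.1, h0, map_zero]

theorem numberOp_wedge (i : BCIndex) (S : Finset BCIndex) :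
    numberOp i (wedge S) = (if i ∈ S then (1 : ℂ) else 0) • wedge S := by
  by_cases hi : i ∈ S
  · have hp : S.toList.Perm (i :: (S.erase i).toList) := by
      simpa only [Finset.insert_erase hi] using Finset.toList_insert (Finset.notMem_erase i S)
    have hn : i ∉ (S.erase i).toList := by simp
    have key : numberOp i (wedgeList (i :: (S.erase i).toList)) =
        wedgeList (i :: (S.erase i).toList) := by
      rw [numberOp, LinearMap.comp_apply, contractLeft_wedgeList_cons_self hn,
        LinearMap.mulLeft_apply, wedgeList_cons]
    rw [if_pos hi, one_smul, wedge]
    rcases wedgeList_perm hp with h | h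
    · rw [h, key]
    · rw [h, map_neg, key]
  · rw [if_neg hi, zero_smul, numberOp, LinearMap.comp_apply, wedge,
      contractLeft_wedgeList_of_notMem (by simpa using hi), map_zero]

theorem wedgeList_eq_wedge {L : List BCIndex} (h : L.Nodup) :
    wedgeList L = wedge L.toFinset ∨ wedgeList L = -wedge L.toFinset :=
  wedgeList_perm (List.toFinset_toList h).symm

theorem linearIndependent_wedge : LinearIndependent ℂ wedge := by
  let t : BCIndex → ℂ := fun i => 2 ^ 2 ^ Encodable.encode i
  let d : BCSpace →ₗ[ℂ] BCSpace := Finsupp.linearCombination ℂ fun i => t i • bv i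
  have hd (i : BCIndex) : d (bv i) = t i • bv i :=
    (Finsupp.linearCombination_single ℂ _ _).trans (one_smul _ _)
  have hlist (L : List BCIndex) :
      ExteriorAlgebra.map d (wedgeList L) = (L.map t).prod • wedgeList L := by
    induction L with
    | nil => simp [wedgeList]
    | cons i L ih =>
      rw [wedgeList_cons, map_mul, ih, map_apply_ι, hd, map_smul, smul_mul_smul_comm,
        List.map_cons, List.prod_cons]
  refine Module.End.eigenvectors_linearIndependent' (ExteriorAlgebra.map d).toLinearMap
    (fun S : Finset BCIndex => ∏ i ∈ S, t i) ?_ wedge fun S => ?_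
  · intro S S' h
    simp only [t, Finset.prod_pow_eq_pow_sum] at h
    have h2 : ∑ i ∈ S, 2 ^ Encodable.encode i = ∑ i ∈ S', 2 ^ Encodable.encode i :=
      Nat.pow_right_injective le_rfl (by exact_mod_cast h)
    let f : BCIndex ↪ ℕ := ⟨Encodable.encode, Encodable.encode_injective⟩
    apply Finset.map_injective f
    apply Finset.geomSum_injective (n := 2) le_rfl
    simpa [f] using h2
  · refine ⟨Module.End.mem_eigenspace_iff.mpr ?_, wedgeList_ne_zero S.nodup_toList⟩
    refine (hlist S.toList).trans ?_
    rw [Finset.prod_map_toList]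
    rfl

theorem wedgeList_mem_span_wedge (L : List BCIndex) :
    wedgeList L ∈ Submodule.span ℂ (Set.range wedge) := by
  by_cases h : L.Nodup
  · rcases wedgeList_eq_wedge h with h | h <;> rw [h]
    · exact Submodule.subset_span ⟨_, rfl⟩
    · exact neg_mem (Submodule.subset_span ⟨_, rfl⟩)
  · rw [wedgeList_eq_zero h]
    exact zero_mem _

theorem span_wedge : ⊤ ≤ Submodule.span ℂ (Set.range wedge) := by
  have hone : (1 : FockF) ∈ Submodule.span ℂ (Set.range wedge) :=
    wedgeList_mem_span_wedge []
  rintro x -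
  induction x using CliffordAlgebra.left_induction with
  | algebraMap r =>
    rw [Algebra.algebraMap_eq_smul_one]
    exact Submodule.smul_mem _ _ hone
  | add x y hx hy => exact add_mem hx hy
  | ι_mul x m hx =>
    change ι ℂ m * x ∈ _
    induction m using Finsupp.induction_linear with
    | zero => simp
    | add m m' h h' =>
      rw [map_add, add_mul]
      exact add_mem h h'
    | single i c =>
      have hi : (Finsupp.single i c : BCSpace) = c • bv i := by simp [bv]
      rw [hi, map_smul, smul_mul_assoc]
      refine Submodule.smul_mem _ _ ?_
      induction hx using Submodule.span_induction with
      | mem x h =>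
        obtain ⟨S, rfl⟩ := h
        rw [wedge, ← wedgeList_cons]
        exact wedgeList_mem_span_wedge _
      | zero => simp
      | add x y _ _ hx hy =>
        rw [mul_add]
        exact add_mem hx hy
      | smul c x _ hx =>
        rw [mul_smul_comm]
        exact Submodule.smul_mem _ _ hx

/-- The basis of wedge monomials of the Fock space. -/
def wedgeBasis : Module.Basis (Finset BCIndex) ℂ FockF :=
  Module.Basis.mk linearIndependent_wedge span_wedge

theorem wedgeBasis_apply (S : Finset BCIndex) : wedgeBasis S = wedge S :=
  Module.Basis.mk_apply _ _ _

/-- The number of `v`-type indices minus the number of `w`-type indices. -/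
def charge (S : Finset BCIndex) : ℤ := (S.toLeft.card : ℤ) - S.toRight.card

theorem chargeOf_eq_charge {L : List BCIndex} (h : L.Nodup) :
    chargeOf L = charge L.toFinset := by
  induction L with
  | nil => rfl
  | cons i L ih =>
    rw [List.nodup_cons] at h
    have ih := ih h.2
    rw [List.toFinset_cons]
    rcases i with i | i
    · have hi : i ∉ L.toFinset.toLeft := by simpa using h.1
      simp only [chargeOf, charge, List.countP_cons, Finset.toLeft_insert_inl,
        Finset.toRight_insert_inl, Finset.card_insert_of_notMem hi, Sum.isLeft_inl,
        Sum.isRight_inl] at ih ⊢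
      grind
    · have hi : i ∉ L.toFinset.toRight := by simpa using h.1
      simp only [chargeOf, charge, List.countP_cons, Finset.toLeft_insert_inr,
        Finset.toRight_insert_inr, Finset.card_insert_of_notMem hi, Sum.isLeft_inr,
        Sum.isRight_inr] at ih ⊢
      grind

theorem FF_eq_span (l : ℤ) :
    FF l = Submodule.span ℂ (wedgeBasis '' {S | charge S = l}) := by
  apply le_antisymm <;> refine Submodule.span_le.mpr ?_
  · rintro x ⟨L, hL, rfl⟩
    change wedgeList L ∈ _
    by_cases h : L.Nodup
    · have hm : wedge L.toFinset ∈ Submodule.span ℂ (wedgeBasis '' {S | charge S = l}) :=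
        Submodule.subset_span ⟨_, (chargeOf_eq_charge h).symm.trans hL, wedgeBasis_apply _⟩
      rcases wedgeList_eq_wedge h with h | h <;> rw [h]
      · exact hm
      · exact neg_mem hm
    · rw [wedgeList_eq_zero h]
      exact zero_mem _
  · rintro _ ⟨S, hS, rfl⟩
    refine Submodule.subset_span ⟨S.toList, ?_, wedgeBasis_apply S⟩
    rw [chargeOf_eq_charge S.nodup_toList, Finset.toList_toFinset]
    exact hS

theorem wedgeBasis_repr_numberOp (i : BCIndex) (x : FockF) (S : Finset BCIndex) :
    wedgeBasis.repr (numberOp i x) S = (if i ∈ S then 1 else 0) * wedgeBasis.repr x S := by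
  have h : wedgeBasis.coord S ∘ₗ numberOp i =
      (if i ∈ S then (1 : ℂ) else 0) • wedgeBasis.coord S := by
    refine wedgeBasis.ext fun T => ?_
    rw [LinearMap.comp_apply, wedgeBasis_apply, numberOp_wedge, ← wedgeBasis_apply]
    by_cases h : T = S
    · subst h
      simp only [map_smul, LinearMap.smul_apply]
    · simp only [map_smul, LinearMap.smul_apply, Module.Basis.coord_apply,
        Module.Basis.repr_self, Finsupp.single_eq_of_ne' h, smul_zero]
  exact LinearMap.congr_fun h x

theorem finite_support_numberOp (x : FockF) : {i | numberOp i x ≠ 0}.Finite := by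
  refine ((wedgeBasis.repr x).support.biUnion id).finite_toSet.subset fun i hi => ?_
  obtain ⟨S, hS⟩ := DFunLike.ne_iff.mp ((wedgeBasis.repr.map_ne_zero_iff).mpr hi)
  rw [wedgeBasis_repr_numberOp] at hS
  have h1 : i ∈ S := by by_contra h; simp [h] at hS
  simp only [Finset.coe_biUnion, Set.mem_iUnion]
  exact ⟨S, by simpa [h1] using hS, h1⟩

/-- The bijection between modes and basis indices: `k ≤ 0` labels `v_{-k}`, `k ≥ 1` labels `w_k`. -/
def modeEquiv : ℤ ≃ BCIndex where
  toFun k := if k ≤ 0 then Sum.inl (-k).toNat else Sum.inr (k - 1).toNat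
  invFun := Sum.elim (fun n => -n) (fun n => n + 1)
  left_inv k := by
    dsimp only
    split_ifs
    · simp only [Sum.elim_inl]; omega
    · simp only [Sum.elim_inr]; omega
  right_inv i := by
    rcases i with n | n
    · simp
    · have : ¬ ((n : ℤ) + 1 ≤ 0) := by omega
      simp [this]

theorem nbc_neg_self (k : ℤ) :
    nbc k (-k) = (if k ≤ 0 then (1 : ℂ) else -1) • numberOp (modeEquiv k) := by
  by_cases h : k ≤ 0
  · have h1 : ¬ (1 ≤ k ∧ -k ≤ -1) := by omega
    have h2 : (0 : ℤ) ≤ -k := by omega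
    rw [nbc, if_neg h1, bOp, if_pos h, cOp, if_pos h2]
    simp [modeEquiv, h, numberOp]
  · have h1 : 1 ≤ k ∧ -k ≤ -1 := by omega
    have h2 : ¬ (0 : ℤ) ≤ -k := by omega
    rw [nbc, if_pos h1, bOp, if_neg h, cOp, if_neg h2]
    simp only [modeEquiv, h, numberOp, Equiv.coe_fn_mk, if_false, neg_neg]
    exact (neg_one_smul ℂ _).symm

theorem wedgeBasis_repr_finsum_nbc (f : ℤ → ℂ) (x : FockF) (S : Finset BCIndex) :
    wedgeBasis.repr (∑ᶠ k : ℤ, f k • nbc k (-k) x) S =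
      ((∑ n ∈ S.toLeft, f (-n)) - ∑ n ∈ S.toRight, f (n + 1)) * wedgeBasis.repr x S := by
  let g : BCIndex → ℂ := Sum.elim (fun n => f (-n)) (fun n => -f (n + 1))
  have hg : ∑ᶠ k : ℤ, f k • nbc k (-k) x = ∑ᶠ i, g i • numberOp i x := by
    refine finsum_eq_of_bijective modeEquiv modeEquiv.bijective fun k => ?_
    rw [nbc_neg_self, LinearMap.smul_apply, smul_smul]
    congr 1
    by_cases h : k ≤ 0
    · have : -((-k).toNat : ℤ) = k := by omega
      simp only [modeEquiv, Equiv.coe_fn_mk, h, if_true, g, Sum.elim_inl, this, mul_one]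
    · have : ((k - 1).toNat : ℤ) + 1 = k := by omega
      simp only [modeEquiv, Equiv.coe_fn_mk, h, if_false, g, Sum.elim_inr, this, mul_neg, mul_one]
  have hfin : (Function.support fun i => g i • numberOp i x).Finite :=
    (finite_support_numberOp x).subset fun i hi h => hi (by simp [h])
  have hsum : (∑ n ∈ S.toLeft, f (-n)) - ∑ n ∈ S.toRight, f (n + 1) = ∑ i ∈ S, g i := by
    rw [← Finset.toLeft_disjSum_toRight (u := S), Finset.sum_disjSum]
    simp [g, sub_eq_add_neg]
  rw [hg, hsum]
  refine ((wedgeBasis.coord S).toAddMonoidHom.map_finsum hfin).trans ?_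
  have hterm (i : BCIndex) : (wedgeBasis.coord S).toAddMonoidHom (g i • numberOp i x) =
      if i ∈ S then g i * wedgeBasis.repr x S else 0 := by
    change wedgeBasis.repr (g i • numberOp i x) S = _
    rw [map_smul, Finsupp.smul_apply, wedgeBasis_repr_numberOp, smul_eq_mul]
    split_ifs <;> ring
  simp only [hterm]
  rw [finsum_eq_sum_of_support_subset (s := S) _ fun i hi => by by_contra h; simp_all,
    Finset.sum_ite_of_true (fun _ h => h), Finset.sum_mul]

/-- The `L_0`-weight of a wedge monomial. -/
def energy (S : Finset BCIndex) : ℕ := (∑ n ∈ S.toLeft, n) + ∑ n ∈ S.toRight, (n + 1)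

/-- The `W̃_0`-weight of a wedge monomial. -/
def spinWeight (S : Finset BCIndex) : ℤ :=
  (∑ n ∈ S.toLeft, (n : ℤ) ^ 2) - ∑ n ∈ S.toRight, ((n : ℤ) + 1) ^ 2

theorem wedgeBasis_repr_Lzero (x : FockF) (S : Finset BCIndex) :
    wedgeBasis.repr (Lzero x) S = energy S * wedgeBasis.repr x S := by
  rw [Lzero, wedgeBasis_repr_finsum_nbc fun k => (-k : ℂ)]
  simp [energy, Finset.sum_add_distrib]
  ring_nf
  simp

theorem wedgeBasis_repr_Wzero (x : FockF) (S : Finset BCIndex) :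
    wedgeBasis.repr (Wzero x) S = spinWeight S * wedgeBasis.repr x S := by
  rw [Wzero, wedgeBasis_repr_finsum_nbc fun k => (k : ℂ) ^ 2]
  simp [spinWeight]

theorem eq_smul_iff_support_subset {ι' K E : Type*} [Field K] [AddCommGroup E] [Module K E]
    (b : Module.Basis ι' K E) {w : ι' → K} {x y : E} (h : ∀ i, b.repr y i = w i * b.repr x i)
    (μ : K) : y = μ • x ↔ ↑(b.repr x).support ⊆ {i | w i = μ} := by
  rw [← b.repr.injective.eq_iff, DFunLike.ext_iff]
  refine forall_congr' fun i => ?_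
  simp only [h, map_smul, Finsupp.smul_apply, smul_eq_mul, mul_eq_mul_right_iff, Finset.mem_coe,
    Finsupp.mem_support_iff, Set.mem_ofPred_eq]
  tauto

theorem jointEigenspace_eq (l : ℤ) (N : ℕ) (M : ℤ) :
    {x : FockF | x ∈ FF l ∧ Lzero x = (N : ℂ) • x ∧ Wzero x = (M : ℂ) • x} =
      Submodule.span ℂ (wedgeBasis '' {S | charge S = l ∧ energy S = N ∧ spinWeight S = M}) := by
  ext x
  rw [Set.mem_ofPred_eq, SetLike.mem_coe, FF_eq_span, Module.Basis.mem_span_image,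
    Module.Basis.mem_span_image,
    eq_smul_iff_support_subset wedgeBasis (wedgeBasis_repr_Lzero x),
    eq_smul_iff_support_subset wedgeBasis (wedgeBasis_repr_Wzero x),
    ← Set.subset_inter_iff, ← Set.subset_inter_iff]
  have : {S | charge S = l} ∩ ({S | (energy S : ℂ) = N} ∩ {S | (spinWeight S : ℂ) = M}) =
      {S | charge S = l ∧ energy S = N ∧ spinWeight S = M} := by
    ext S
    simp
  rw [this]

/-- Finite sets of basis indices correspond to pairs `(A, B)` of a finite set of nonnegative
integers and a finite set of positive integers. -/
def finsetPairEquiv :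
    Finset BCIndex ≃ {p : Finset ℕ × Finset ℕ // ∀ b ∈ p.2, 0 < b} where
  toFun S := ⟨(S.toLeft, S.toRight.map (addRightEmbedding 1)), by simp⟩
  invFun p := p.1.1.disjSum (p.1.2.image fun n => n - 1)
  left_inv S := by
    simp only [Finset.map_eq_image, Finset.image_image]
    convert Finset.toLeft_disjSum_toRight (u := S)
    ext n
    simp
  right_inv p := by
    obtain ⟨⟨A, B⟩, hB⟩ := p
    ext n
    · simp
    · simp only [Finset.toRight_disjSum, Finset.mem_map, Finset.mem_image, exists_exists_and_eq_and,
        addRightEmbedding_apply]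
      constructor
      · rintro ⟨b, hb, rfl⟩
        rwa [Nat.sub_add_cancel (hB b hb)]
      · exact fun h => ⟨n, h, Nat.sub_add_cancel (hB n h)⟩

/-- The full character of `F^l`:
`Tr_{⊕_l F^l} z^{−j₀} q^{L₀} p^{W̃₀} = (1+z)∏_{n≥1}(1 + z qⁿ p^{n²})(1 + z⁻¹ qⁿ p^{−n²})`,
stated as: the dimension of the joint `(L₀, W̃₀)`-eigenspace of `F^l` with eigenvalues
`(N, M)` equals the number of pairs `(A, B)` with `A` a finite set of nonnegative
integers and `B` a finite set of positive integers such that `|A| − |B| = l`,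
`Σ A + Σ B = N` and `Σ_{a∈A} a² − Σ_{b∈B} b² = M`. -/
theorem character_of_Fl (l : ℤ) (N : ℕ) (M : ℤ) :
    Module.finrank ℂ
      ↥(Submodule.span ℂ
        {x : FockF | x ∈ FF l ∧ Lzero x = (N : ℂ) • x ∧ Wzero x = (M : ℂ) • x})
    = Nat.card {p : Finset ℕ × Finset ℕ //
        (∀ b ∈ p.2, 0 < b) ∧
        (p.1.card : ℤ) - (p.2.card : ℤ) = l ∧
        (∑ a ∈ p.1, a) + (∑ b ∈ p.2, b) = N ∧
        (∑ a ∈ p.1, (a : ℤ) ^ 2) - (∑ b ∈ p.2, (b : ℤ) ^ 2) = M} := by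
  have hli : LinearIndependent ℂ fun S : {S // charge S = l ∧ energy S = N ∧ spinWeight S = M} =>
      wedgeBasis S.1 := wedgeBasis.linearIndependent.comp _ Subtype.val_injective
  rw [jointEigenspace_eq, Submodule.span_span, Set.image_eq_range]
  refine (Module.finrank_eq_nat_card_basis (Module.Basis.span hli)).trans ?_
  refine Nat.card_congr ((finsetPairEquiv.subtypeEquiv fun S => ?_).trans
    (Equiv.subtypeSubtypeEquivSubtypeInter _ _))
  simp [finsetPairEquiv, charge, energy, spinWeight]
end
end

section
/- For every integer l and every natural number N, the number of pairs (A, B) of finite sets of positive integers with |A| − |B| = l and Σ_{a∈A} a + Σ_{b∈B} b = N equals Σ_k (−1)^{k+l}·p(N − k(k+1)/2), where the sum runs over all integers k with k ≥ |l| and k(k+1)/2 ≤ N, and p(n) denotes the number of partitions of n. -/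
theorem Nat.choose_two_succ (k : ℕ) : (k + 1).choose 2 = k + k.choose 2 := by
  rw [Nat.choose_succ_succ', Nat.choose_one_right]

/-- The translate of a finite set of naturals by one. -/
def Finset.succShift (A : Finset ℕ) : Finset ℕ := A.map ⟨Nat.succ, Nat.succ_injective⟩

namespace Finset

theorem succ_mem_succShift {A : Finset ℕ} {a : ℕ} : a + 1 ∈ A.succShift ↔ a ∈ A := by
  simp [succShift]

theorem zero_notMem_succShift (A : Finset ℕ) : 0 ∉ A.succShift := by
  simp [succShift]

theorem card_succShift (A : Finset ℕ) : A.succShift.card = A.card := by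
  simp [succShift]

theorem sum_succShift (A : Finset ℕ) : ∑ a ∈ A.succShift, a = ∑ a ∈ A, a + A.card := by
  simp [succShift, sum_add_distrib]

theorem succShift_injective : Function.Injective succShift :=
  map_injective _

theorem card_insert_zero_succShift (A : Finset ℕ) :
    (insert 0 A.succShift).card = A.card + 1 := by
  rw [card_insert_of_notMem (zero_notMem_succShift A), card_succShift]

theorem sum_insert_zero_succShift (A : Finset ℕ) :
    ∑ a ∈ insert 0 A.succShift, a = ∑ a ∈ A, a + A.card := by
  rw [sum_insert (zero_notMem_succShift A), sum_succShift, zero_add]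

theorem insert_zero_succShift_injective :
    Function.Injective fun A : Finset ℕ ↦ insert 0 A.succShift := fun A B h ↦ by
  apply succShift_injective
  simpa [zero_notMem_succShift] using congrArg (erase · 0) h

theorem succShift_ne_insert_zero (A B : Finset ℕ) : A.succShift ≠ insert 0 B.succShift :=
  fun h ↦ zero_notMem_succShift A (h ▸ mem_insert_self _ _)

theorem exists_eq_succShift {A : Finset ℕ} (hA : ∀ a ∈ A, 0 < a) : ∃ B, A = succShift B := by
  refine ⟨A.image Nat.pred, ?_⟩
  ext (_ | a)
  · simpa [zero_notMem_succShift] using fun h ↦ (hA 0 h).ne' rfl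
  · rw [succ_mem_succShift, mem_image]
    constructor
    · exact fun h ↦ ⟨a + 1, h, rfl⟩
    · rintro ⟨b, hb, rfl⟩
      rwa [Nat.pred_eq_sub_one, Nat.sub_add_cancel (hA b hb)]

theorem eq_succShift_or_eq_insert_zero (A : Finset ℕ) :
    (∃ B, A = succShift B) ∨ ∃ B, A = insert 0 (succShift B) := by
  by_cases h : 0 ∈ A
  · obtain ⟨B, hB⟩ := exists_eq_succShift (A := A.erase 0) fun a ha ↦
      Nat.pos_of_ne_zero (ne_of_mem_erase ha)
    exact .inr ⟨B, by rw [← hB, insert_erase h]⟩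
  · exact .inl (exists_eq_succShift fun a ha ↦ Nat.pos_of_ne_zero fun h0 ↦ h (h0 ▸ ha))

theorem choose_two_card_le_sum (A : Finset ℕ) : A.card.choose 2 ≤ ∑ a ∈ A, a := by
  induction A using induction_on_max with
  | empty => simp
  | insert a s hs ih =>
    have ha : a ∉ s := fun h ↦ (hs a h).false
    have hc : s.card ≤ a := by
      simpa using card_le_card fun x hx ↦ mem_range.2 (hs x hx)
    rw [card_insert_of_notMem ha, sum_insert ha, Nat.choose_two_succ]
    exact add_le_add hc ih

theorem finite_setOf_sum_le (N : ℕ) : {A : Finset ℕ | ∑ a ∈ A, a ≤ N}.Finite := by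
  refine (range (N + 1)).powerset.finite_toSet.subset fun A hA ↦ ?_
  exact mem_coe.2 <| mem_powerset.2 fun a ha ↦
    mem_range.2 (Nat.lt_succ_of_le ((single_le_sum (fun _ _ ↦ Nat.zero_le _) ha).trans hA))

end Finset

/-- The finite sets of naturals of cardinality `k` and sum `n`. -/
def finsetsCardSum (k n : ℕ) : Set (Finset ℕ) := {A | A.card = k ∧ ∑ a ∈ A, a = n}

/-- The multisets of positive naturals at most `k`, of sum `n`. -/
def boundedPartitions (k n : ℕ) : Set (Multiset ℕ) :=
  {m | (∀ a ∈ m, 0 < a ∧ a ≤ k) ∧ m.sum = n}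

/-- The pairs of finite sets of naturals of charge `l` and energy `N`, where an element `a` has
energy `a + 1` in the first set as well as in the second. -/
def positivePairs (l N : ℕ) : Set (Finset ℕ × Finset ℕ) :=
  {p | p.1.card = p.2.card + l ∧
    (∑ a ∈ p.1, a + p.1.card) + (∑ b ∈ p.2, b + p.2.card) = N}

/-- The pairs of finite sets of naturals of charge `l` and energy `N`, where an element `a` has
energy `a + 1` in the first set and energy `a` in the second. -/
def chargedPairs (l N : ℕ) : Set (Finset ℕ × Finset ℕ) :=
  {p | p.1.card = p.2.card + l ∧ (∑ a ∈ p.1, a + p.1.card) + ∑ b ∈ p.2, b = N}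

theorem finite_finsetsCardSum (k n : ℕ) : (finsetsCardSum k n).Finite :=
  (Finset.finite_setOf_sum_le n).subset fun _ hA ↦ hA.2.le

theorem finite_chargedPairs (l N : ℕ) : (chargedPairs l N).Finite := by
  refine ((Finset.finite_setOf_sum_le N).prod (Finset.finite_setOf_sum_le N)).subset ?_
  rintro ⟨A, B⟩ ⟨-, h⟩
  simp only [Set.mem_prod, Set.mem_ofPred_eq] at h ⊢
  omega

theorem finite_positivePairs (l N : ℕ) : (positivePairs l N).Finite := by
  refine ((Finset.finite_setOf_sum_le N).prod (Finset.finite_setOf_sum_le N)).subset ?_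
  rintro ⟨A, B⟩ ⟨-, h⟩
  simp only [Set.mem_prod, Set.mem_ofPred_eq] at h ⊢
  omega

theorem finite_boundedPartitions (k n : ℕ) : (boundedPartitions k n).Finite := by
  refine (Set.finite_range (Nat.Partition.parts (n := n))).subset fun m hm ↦ ?_
  exact ⟨⟨m, fun h ↦ (hm.1 _ h).1, hm.2⟩, rfl⟩

theorem ncard_boundedPartitions_self (n : ℕ) :
    (boundedPartitions n n).ncard = Fintype.card (Nat.Partition n) := by
  rw [← Nat.card_eq_fintype_card, ← Set.ncard_univ,
    ← Set.ncard_image_of_injective _ (f := Nat.Partition.parts (n := n))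
      fun _ _ ↦ Nat.Partition.ext]
  congr 1
  ext m
  simp only [Set.image_univ, Set.mem_range]
  constructor
  · exact fun hm ↦ ⟨⟨m, fun h ↦ (hm.1 _ h).1, hm.2⟩, rfl⟩
  · rintro ⟨p, rfl⟩
    exact ⟨fun a ha ↦ ⟨p.parts_pos ha, (Multiset.le_sum_of_mem ha).trans_eq p.parts_sum⟩,
      p.parts_sum⟩

theorem ncard_boundedPartitions_succ_add (k n : ℕ) :
    (boundedPartitions (k + 1) (n + (k + 1))).ncard =
      (boundedPartitions (k + 1) n).ncard + (boundedPartitions k (n + (k + 1))).ncard := by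
  have hinj : Function.Injective fun m : Multiset ℕ ↦ (k + 1) ::ₘ m :=
    fun _ _ ↦ (Multiset.cons_inj_right _).1
  rw [← Set.ncard_image_of_injective (boundedPartitions (k + 1) n) hinj,
    ← Set.ncard_union_eq _ ((finite_boundedPartitions _ _).image _) (finite_boundedPartitions _ _)]
  · congr 1
    ext m
    constructor
    · rintro ⟨hm, hs⟩
      by_cases hk : k + 1 ∈ m
      · obtain ⟨t, rfl⟩ := Multiset.exists_cons_of_mem hk
        refine .inl ⟨t, ⟨fun a ha ↦ hm a (Multiset.mem_cons_of_mem ha), ?_⟩, rfl⟩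
        rw [Multiset.sum_cons] at hs
        omega
      · refine .inr ⟨fun a ha ↦ ⟨(hm a ha).1, ?_⟩, hs⟩
        have : a ≠ k + 1 := fun h ↦ hk (h ▸ ha)
        have := (hm a ha).2
        omega
    · rintro (⟨t, ⟨ht, hs⟩, rfl⟩ | ⟨hm, hs⟩)
      · refine ⟨fun a ha ↦ ?_, by simp [hs, add_comm]⟩
        rcases Multiset.mem_cons.1 ha with rfl | ha
        · exact ⟨k.succ_pos, le_rfl⟩
        · exact ht a ha
      · exact ⟨fun a ha ↦ ⟨(hm a ha).1, (hm a ha).2.trans k.le_succ⟩, hs⟩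
  · rw [Set.disjoint_left]
    rintro _ ⟨t, -, rfl⟩ ⟨h, -⟩
    have := (h (k + 1) (Multiset.mem_cons_self _ _)).2
    omega

theorem boundedPartitions_succ_of_le {k n : ℕ} (h : n ≤ k) :
    boundedPartitions (k + 1) n = boundedPartitions k n := by
  ext m
  refine ⟨fun ⟨hm, hs⟩ ↦ ⟨fun a ha ↦ ⟨(hm a ha).1, ?_⟩, hs⟩,
    fun ⟨hm, hs⟩ ↦ ⟨fun a ha ↦ ⟨(hm a ha).1, (hm a ha).2.trans k.le_succ⟩, hs⟩⟩
  exact (Multiset.le_sum_of_mem ha).trans (hs.trans_le h)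

theorem ncard_finsetsCardSum_succ_add (k n : ℕ) :
    (finsetsCardSum (k + 1) (n + k)).ncard =
      {A : Finset ℕ | A.card = k + 1 ∧ ∑ a ∈ A, a + 1 = n}.ncard +
        (finsetsCardSum k n).ncard := by
  have hfin : {A : Finset ℕ | A.card = k + 1 ∧ ∑ a ∈ A, a + 1 = n}.Finite :=
    (Finset.finite_setOf_sum_le n).subset fun A hA ↦ (Nat.le_succ _).trans hA.2.le
  rw [← Set.ncard_image_of_injective {A : Finset ℕ | _} Finset.succShift_injective,
    ← Set.ncard_image_of_injective (finsetsCardSum k n)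
      Finset.insert_zero_succShift_injective,
    ← Set.ncard_union_eq _ (hfin.image _) ((finite_finsetsCardSum _ _).image _)]
  · congr 1
    ext A
    constructor
    · rintro ⟨hc, hs⟩
      rcases A.eq_succShift_or_eq_insert_zero with ⟨B, rfl⟩ | ⟨B, rfl⟩
      · rw [Finset.card_succShift] at hc
        rw [Finset.sum_succShift] at hs
        exact .inl ⟨B, ⟨hc, by omega⟩, rfl⟩
      · rw [Finset.card_insert_zero_succShift] at hc
        rw [Finset.sum_insert_zero_succShift] at hs
        exact .inr ⟨B, ⟨by omega, by omega⟩, rfl⟩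
    · rintro (⟨B, ⟨hc, hs⟩, rfl⟩ | ⟨B, ⟨hc, hs⟩, rfl⟩)
      · refine ⟨by rw [Finset.card_succShift, hc], ?_⟩
        rw [Finset.sum_succShift]
        omega
      · refine ⟨by rw [Finset.card_insert_zero_succShift, hc], ?_⟩
        rw [Finset.sum_insert_zero_succShift]
        omega
  · rw [Set.disjoint_left]
    rintro _ ⟨A, -, rfl⟩ ⟨B, -, h⟩
    exact Finset.succShift_ne_insert_zero A B h.symm

/-- Subtracting a staircase and conjugating: sets of `k` naturals correspond to partitions into
parts of size at most `k`. -/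
theorem ncard_finsetsCardSum_add_choose (k n : ℕ) :
    (finsetsCardSum k (n + k.choose 2)).ncard = (boundedPartitions k n).ncard := by
  induction k generalizing n with
  | zero =>
    rcases n.eq_zero_or_pos with rfl | hn
    · have h₁ : finsetsCardSum 0 (0 + Nat.choose 0 2) = {∅} := by
        ext A
        simp +contextual [finsetsCardSum]
      have h₂ : boundedPartitions 0 0 = {0} := by
        ext m
        simp only [boundedPartitions, Set.mem_ofPred_eq, Set.mem_singleton_iff]
        refine ⟨fun h ↦ Multiset.eq_zero_of_forall_notMem fun a ha ↦ ?_, by rintro rfl; simp⟩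
        have := h.1 a ha
        omega
      rw [h₁, h₂, Set.ncard_singleton, Set.ncard_singleton]
    · have h₁ : finsetsCardSum 0 (n + Nat.choose 0 2) = ∅ := by
        rw [Set.eq_empty_iff_forall_notMem]
        rintro A ⟨hc, hs⟩
        rw [Finset.card_eq_zero.1 hc] at hs
        simp at hs
        omega
      have h₂ : boundedPartitions 0 n = ∅ := by
        rw [Set.eq_empty_iff_forall_notMem]
        rintro m ⟨hm, hs⟩
        have : m = 0 := Multiset.eq_zero_of_forall_notMem fun a ha ↦ by
          have := hm a ha
          omega
        subst this
        simp at hs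
        omega
      rw [h₁, h₂, Set.ncard_empty, Set.ncard_empty]
  | succ k ih =>
    have hrec (n : ℕ) : (finsetsCardSum (k + 1) (n + (k + 1).choose 2)).ncard =
        {A : Finset ℕ | A.card = k + 1 ∧ ∑ a ∈ A, a + 1 = n + k.choose 2}.ncard +
          (boundedPartitions k n).ncard := by
      rw [Nat.choose_two_succ, ← ih, ← ncard_finsetsCardSum_succ_add]
      congr 2
      omega
    induction n using Nat.strong_induction_on with
    | _ n ihn =>
      rw [hrec]
      rcases Nat.lt_or_ge n (k + 1) with hn | hn
      · rw [boundedPartitions_succ_of_le (Nat.le_of_lt_succ hn), Nat.add_eq_right,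
          Set.ncard_eq_zero (s := _) (by
            exact (Finset.finite_setOf_sum_le (n + k.choose 2)).subset
              fun A hA ↦ (Nat.le_succ _).trans hA.2.le),
          Set.eq_empty_iff_forall_notMem]
        rintro A ⟨hc, hs⟩
        have := A.choose_two_card_le_sum
        rw [hc, Nat.choose_two_succ] at this
        omega
      · obtain ⟨m, rfl⟩ := Nat.exists_eq_add_of_le' hn
        rw [ncard_boundedPartitions_succ_add, ← ihn m (by omega), Nat.add_right_cancel_iff]
        congr 1
        ext A
        refine and_congr_right fun _ ↦ ?_
        rw [Nat.choose_two_succ]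
        omega

theorem choose_two_le_of_mem_chargedPairs {l N : ℕ} {p : Finset ℕ × Finset ℕ}
    (hp : p ∈ chargedPairs l N) : (p.2.card + l + 1).choose 2 ≤ N := by
  obtain ⟨hc, hs⟩ := hp
  have := p.1.choose_two_card_le_sum
  rw [← hc, Nat.choose_two_succ]
  omega

theorem chargedPairs_eq_empty {l N : ℕ} (h : N < (l + 1).choose 2) : chargedPairs l N = ∅ := by
  rw [Set.eq_empty_iff_forall_notMem]
  intro p hp
  refine h.not_ge (le_trans (Nat.choose_le_choose 2 ?_) (choose_two_le_of_mem_chargedPairs hp))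
  omega

theorem ncard_chargedPairs (l N : ℕ) :
    (chargedPairs l N).ncard = (positivePairs l N).ncard + (positivePairs (l + 1) N).ncard := by
  have h₁ : Function.Injective (Prod.map (id : Finset ℕ → Finset ℕ) Finset.succShift) :=
    Function.injective_id.prodMap Finset.succShift_injective
  have h₂ : Function.Injective
      (Prod.map (id : Finset ℕ → Finset ℕ) fun A ↦ insert 0 (Finset.succShift A)) :=
    Function.injective_id.prodMap Finset.insert_zero_succShift_injective
  rw [← Set.ncard_image_of_injective (positivePairs l N) h₁,
    ← Set.ncard_image_of_injective (positivePairs (l + 1) N) h₂,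
    ← Set.ncard_union_eq _ ((finite_positivePairs _ _).image _)
      ((finite_positivePairs _ _).image _)]
  · congr 1
    ext ⟨A, B⟩
    constructor
    · rintro ⟨hc, hs⟩
      rcases B.eq_succShift_or_eq_insert_zero with ⟨B, rfl⟩ | ⟨B, rfl⟩
      · simp only [Finset.card_succShift, Finset.sum_succShift] at hc hs
        exact .inl ⟨(A, B), ⟨hc, hs⟩, rfl⟩
      · simp only [Finset.card_insert_zero_succShift, Finset.sum_insert_zero_succShift] at hc hs
        exact .inr ⟨(A, B), ⟨by simp only; omega, hs⟩, rfl⟩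
    · rintro (⟨⟨A, B⟩, ⟨hc, hs⟩, h⟩ | ⟨⟨A, B⟩, ⟨hc, hs⟩, h⟩) <;> rw [← h]
      · simpa [chargedPairs, Finset.card_succShift, Finset.sum_succShift] using ⟨hc, hs⟩
      · simp only [chargedPairs, Set.mem_ofPred_eq, Prod.map_apply, id,
          Finset.card_insert_zero_succShift, Finset.sum_insert_zero_succShift]
        exact ⟨by simp only at hc; omega, hs⟩
  · rw [Set.disjoint_left]
    rintro _ ⟨⟨A, B⟩, -, rfl⟩ ⟨⟨A', B'⟩, -, h⟩
    exact Finset.succShift_ne_insert_zero B B' (Prod.ext_iff.1 h).2.symm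

/-- Translating the Maya diagram by one raises the charge by one. -/
theorem ncard_chargedPairs_succ (l N : ℕ) :
    (chargedPairs (l + 1) (N + (l + 1))).ncard = (chargedPairs l N).ncard := by
  have h₁ : Function.Injective (Prod.map Finset.succShift (id : Finset ℕ → Finset ℕ)) :=
    Finset.succShift_injective.prodMap Function.injective_id
  have h₂ : Function.Injective
      (Prod.map (fun A ↦ insert 0 (Finset.succShift A)) (id : Finset ℕ → Finset ℕ)) :=
    Finset.insert_zero_succShift_injective.prodMap Function.injective_id
  rw [ncard_chargedPairs l, add_comm (positivePairs l N).ncard,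
    ← Set.ncard_image_of_injective (positivePairs (l + 1) N) h₁,
    ← Set.ncard_image_of_injective (positivePairs l N) h₂,
    ← Set.ncard_union_eq _ ((finite_positivePairs _ _).image _)
      ((finite_positivePairs _ _).image _)]
  · congr 1
    ext ⟨A, B⟩
    constructor
    · rintro ⟨hc, hs⟩
      rcases A.eq_succShift_or_eq_insert_zero with ⟨A, rfl⟩ | ⟨A, rfl⟩
      · simp only [Finset.card_succShift, Finset.sum_succShift] at hc hs
        exact .inl ⟨(A, B), ⟨hc, by simp only; omega⟩, rfl⟩
      · simp only [Finset.card_insert_zero_succShift, Finset.sum_insert_zero_succShift] at hc hs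
        exact .inr ⟨(A, B), ⟨by simp only; omega, by simp only; omega⟩, rfl⟩
    · rintro (⟨⟨A, B⟩, ⟨hc, hs⟩, h⟩ | ⟨⟨A, B⟩, ⟨hc, hs⟩, h⟩) <;> rw [← h] <;>
        simp only [chargedPairs, Set.mem_ofPred_eq, Prod.map_apply, id, Finset.card_succShift,
          Finset.sum_succShift, Finset.card_insert_zero_succShift,
          Finset.sum_insert_zero_succShift] at hc hs ⊢ <;>
        omega
  · rw [Set.disjoint_left]
    rintro _ ⟨⟨A, B⟩, -, rfl⟩ ⟨⟨A', B'⟩, -, h⟩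
    exact Finset.succShift_ne_insert_zero A A' (Prod.ext_iff.1 h).1.symm

theorem ncard_chargedPairs_add_choose (l N : ℕ) :
    (chargedPairs l (N + (l + 1).choose 2)).ncard = (chargedPairs 0 N).ncard := by
  induction l with
  | zero => simp
  | succ l ih =>
    rw [← ih, ← ncard_chargedPairs_succ l, Nat.choose_two_succ (l + 1)]
    congr 2
    omega

theorem ncard_chargedPairs_self (N : ℕ) :
    (chargedPairs N (N + (N + 1).choose 2)).ncard = (finsetsCardSum N (N + N.choose 2)).ncard := by
  have hN : (N + 1).choose 2 = N + N.choose 2 := by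
    rw [Nat.choose_two_succ]
  rw [← Set.ncard_image_of_injective (finsetsCardSum N _)
    (Prod.mk_left_injective (∅ : Finset ℕ))]
  congr 1
  ext ⟨A, B⟩
  constructor
  · intro h
    obtain rfl : B = ∅ := by
      by_contra hB
      have hle := choose_two_le_of_mem_chargedPairs h
      have hpos := (Finset.nonempty_iff_ne_empty.2 hB).card_pos
      have hmono : (N + 1 + 1).choose 2 ≤ (B.card + N + 1).choose 2 :=
        Nat.choose_le_choose 2 (by omega)
      rw [Nat.choose_two_succ (N + 1)] at hmono
      simp only at hle
      omega
    obtain ⟨hc, hs⟩ := h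
    simp only [Finset.card_empty, Finset.sum_empty] at hc hs
    exact ⟨A, ⟨by omega, by omega⟩, rfl⟩
  · rintro ⟨A', ⟨hc, hs⟩, h⟩
    rw [← h]
    refine ⟨by simp [hc], ?_⟩
    simp only [Finset.sum_empty]
    omega

/-- The coefficient form of the Jacobi triple product identity. -/
theorem ncard_chargedPairs_eq_card_partition (l N : ℕ) :
    (chargedPairs l (N + (l + 1).choose 2)).ncard = Fintype.card (Nat.Partition N) := by
  rw [ncard_chargedPairs_add_choose, ← ncard_chargedPairs_add_choose N, ncard_chargedPairs_self,
    ncard_finsetsCardSum_add_choose, ncard_boundedPartitions_self]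

theorem ncard_positivePairs_add_succ (l N : ℕ) :
    (positivePairs l N).ncard + (positivePairs (l + 1) N).ncard =
      if (l + 1).choose 2 ≤ N then Fintype.card (Nat.Partition (N - (l + 1).choose 2)) else 0 := by
  rw [← ncard_chargedPairs]
  split_ifs with h
  · rw [← ncard_chargedPairs_eq_card_partition l, Nat.sub_add_cancel h]
  · rw [chargedPairs_eq_empty (not_le.1 h), Set.ncard_empty]

theorem ncard_positivePairs (l N : ℕ) :
    ((positivePairs l N).ncard : ℤ) = ∑ k ∈ Finset.range (N + 1),
      if l ≤ k ∧ (k + 1).choose 2 ≤ N then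
        (-1 : ℤ) ^ (k + l) * (Fintype.card (Nat.Partition (N - (k + 1).choose 2)) : ℤ)
      else 0 := by
  have hle (k : ℕ) : k ≤ (k + 1).choose 2 := by
    rw [Nat.choose_two_succ]
    omega
  rcases Nat.lt_or_ge N l with hl | hl
  · have := ncard_positivePairs_add_succ l N
    rw [if_neg (by have := hle l; omega)] at this
    rw [Finset.sum_eq_zero, (by omega : (positivePairs l N).ncard = 0), Nat.cast_zero]
    intro k hk
    rw [Finset.mem_range] at hk
    rw [if_neg (by omega)]
  · have h := ncard_positivePairs_add_succ l N
    have hsum : ((positivePairs l N).ncard : ℤ) + (positivePairs (l + 1) N).ncard =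
        if (l + 1).choose 2 ≤ N then
          (Fintype.card (Nat.Partition (N - (l + 1).choose 2)) : ℤ) else 0 := by
      exact_mod_cast h
    rw [eq_sub_of_add_eq hsum, ncard_positivePairs (l + 1) N, sub_eq_iff_eq_add,
      ← Finset.sum_add_distrib, Finset.sum_eq_single l]
    · simp [Even.neg_one_pow ⟨l, rfl⟩]
    · intro k _ hkl
      rw [← add_assoc, pow_succ]
      split_ifs <;> first | omega | ring
    · intro hmem
      rw [Finset.mem_range] at hmem
      omega
termination_by N + 1 - l

theorem card_strict_pairs (l N : ℕ) :
    Nat.card {p : Finset ℕ × Finset ℕ //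
        (∀ a ∈ p.1, 0 < a) ∧ (∀ b ∈ p.2, 0 < b) ∧
        (p.1.card : ℤ) - (p.2.card : ℤ) = l ∧
        (∑ a ∈ p.1, a) + (∑ b ∈ p.2, b) = N} = (positivePairs l N).ncard := by
  rw [← Set.ncard_image_of_injective (positivePairs l N)
    (Finset.succShift_injective.prodMap Finset.succShift_injective)]
  rw [← Nat.card_coe_set_eq]
  refine Nat.card_congr (Equiv.subtypeEquivRight ?_)
  rintro ⟨A, B⟩
  constructor
  · rintro ⟨hA, hB, hc, hs⟩
    obtain ⟨A, rfl⟩ := Finset.exists_eq_succShift hA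
    obtain ⟨B, rfl⟩ := Finset.exists_eq_succShift hB
    simp only [Finset.card_succShift, Finset.sum_succShift] at hc hs
    exact ⟨(A, B), ⟨by simp only; omega, hs⟩, rfl⟩
  · rintro ⟨⟨A, B⟩, ⟨hc, hs⟩, h⟩
    rw [← h]
    have hpos (C : Finset ℕ) : ∀ c ∈ C.succShift, 0 < c := fun c hcC ↦
      Nat.pos_of_ne_zero fun h0 ↦ C.zero_notMem_succShift (h0 ▸ hcC)
    refine ⟨hpos A, hpos B, ?_, ?_⟩
    · simp only [Prod.map_apply, Finset.card_succShift] at hc ⊢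
      omega
    · simpa only [Prod.map_apply, Finset.sum_succShift] using hs

/-- The coefficient-of-`z^l` form of the character identity
`ψ_l(q,0) = (∏_{n≥1}(1−qⁿ))⁻¹ Σ_{k≥|l|} (−1)^{k+l} q^{k(k+1)/2}`:
the number of pairs `(A, B)` of finite sets of positive integers with `|A| − |B| = l`
and `Σ A + Σ B = N` equals `Σ_{k ≥ |l|, k(k+1)/2 ≤ N} (−1)^{k+l} p(N − k(k+1)/2)`,
where `p` is the partition function. -/
theorem strict_partition_pair_count (l : ℤ) (N : ℕ) :
    (Nat.card {p : Finset ℕ × Finset ℕ //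
        (∀ a ∈ p.1, 0 < a) ∧ (∀ b ∈ p.2, 0 < b) ∧
        (p.1.card : ℤ) - (p.2.card : ℤ) = l ∧
        (∑ a ∈ p.1, a) + (∑ b ∈ p.2, b) = N} : ℤ)
    = ∑ k ∈ Finset.range (N + 1),
        if |l| ≤ (k : ℤ) ∧ k * (k + 1) / 2 ≤ N then
          (-1 : ℤ) ^ ((k : ℤ) + l).toNat *
            (Fintype.card (Nat.Partition (N - k * (k + 1) / 2)) : ℤ)
        else 0 := by
  have hT (k : ℕ) : k * (k + 1) / 2 = (k + 1).choose 2 := by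
    rw [Nat.choose_two_right, Nat.add_sub_cancel, mul_comm]
  simp only [hT]
  obtain ⟨n, rfl | rfl⟩ := l.eq_nat_or_neg
  · rw [card_strict_pairs, ncard_positivePairs]
    refine Finset.sum_congr rfl fun k _ ↦ ?_
    simp only [Nat.abs_cast, Nat.cast_le, ← Nat.cast_add, Int.toNat_natCast]
  · have hswap : Nat.card {p : Finset ℕ × Finset ℕ //
        (∀ a ∈ p.1, 0 < a) ∧ (∀ b ∈ p.2, 0 < b) ∧
        (p.1.card : ℤ) - (p.2.card : ℤ) = -n ∧
        (∑ a ∈ p.1, a) + (∑ b ∈ p.2, b) = N} = (positivePairs n N).ncard := by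
      rw [← card_strict_pairs]
      refine Nat.card_congr ((Equiv.prodComm _ _).subtypeEquiv ?_)
      rintro ⟨A, B⟩
      simp only [Equiv.prodComm_apply, Prod.swap]
      rw [add_comm, and_left_comm, ← neg_inj, neg_neg, neg_sub]
    rw [hswap, ncard_positivePairs]
    refine Finset.sum_congr rfl fun k _ ↦ ?_
    simp only [abs_neg, Nat.abs_cast, Nat.cast_le]
    split_ifs with h
    · obtain ⟨m, rfl⟩ := Nat.exists_eq_add_of_le' h.1
      have : (((m + n : ℕ) : ℤ) + -n).toNat = m := by omega
      rw [this, add_assoc, pow_add _ m, Even.neg_one_pow ⟨n, rfl⟩, mul_one]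
    · rfl
end
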